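/- arXiv:math/9902133 — 3 statements merged into one kernel-verified Lean document; each statement's English description precedes it below -/
import Mathlib

section
/- Let k be an algebraically closed field of characteristic 0 and let q = −1. Then M_q(n,r) has a finite-dimensional irreducible module of dimension 2^{d_0}, where d_0 = ⌊(n+r−1)/2⌋. -/
open scoped BigOperators

/-- Defining relations of the quantized matrix algebra `M_q(n,r)` (generators `Z (i,j)`). -/
inductive QMatRel (k : Type) [Field k] (q : k) (n r : ℕ) :
    FreeAlgebra k (Fin n × Fin r) → FreeAlgebra k (Fin n × Fin r) → Prop
  | row (i : Fin n) (j l : Fin r) (h : j < l) :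
      QMatRel k q n r (FreeAlgebra.ι k (i, j) * FreeAlgebra.ι k (i, l))
        (q • (FreeAlgebra.ι k (i, l) * FreeAlgebra.ι k (i, j)))
  | col (i s : Fin n) (j : Fin r) (h : i < s) :
      QMatRel k q n r (FreeAlgebra.ι k (i, j) * FreeAlgebra.ι k (s, j))
        (q • (FreeAlgebra.ι k (s, j) * FreeAlgebra.ι k (i, j)))
  | cross (i s : Fin n) (j l : Fin r) (h1 : i < s) (h2 : l < j) :
      QMatRel k q n r (FreeAlgebra.ι k (i, j) * FreeAlgebra.ι k (s, l))
        (FreeAlgebra.ι k (s, l) * FreeAlgebra.ι k (i, j))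
  | diag (i s : Fin n) (j l : Fin r) (h1 : i < s) (h2 : j < l) :
      QMatRel k q n r (FreeAlgebra.ι k (i, j) * FreeAlgebra.ι k (s, l))
        (FreeAlgebra.ι k (s, l) * FreeAlgebra.ι k (i, j) +
          (q - q⁻¹) • (FreeAlgebra.ι k (i, l) * FreeAlgebra.ι k (s, j)))

/-- The quantized matrix algebra `M_q(n,r)`. -/
abbrev QMat (k : Type) [Field k] (q : k) (n r : ℕ) : Type := RingQuot (QMatRel k q n r)

/-- The generator `Z_{i,j}` of `M_q(n,r)`. -/
noncomputable def Zgen (k : Type) [Field k] (q : k) (n r : ℕ) (i : Fin n) (j : Fin r) :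
    QMat k q n r :=
  RingQuot.mkAlgHom k (QMatRel k q n r) (FreeAlgebra.ι k (i, j))

/-- Number of inversions (the length) of a permutation. -/
def invCount {t : ℕ} (σ : Equiv.Perm (Fin t)) : ℕ :=
  (Finset.univ.filter (fun p : Fin t × Fin t => p.1 < p.2 ∧ σ p.2 < σ p.1)).card

/-- The `t × t` quantum minor on rows `row 0 < ... < row (t-1)` and columns
`col 0 < ... < col (t-1)`. -/
noncomputable def qMinor (k : Type) [Field k] (q : k) (n r : ℕ) (t : ℕ)
    (row : Fin t → Fin n) (col : Fin t → Fin r) : QMat k q n r :=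
  ∑ σ : Equiv.Perm (Fin t),
    ((-q) ^ invCount σ) • (List.ofFn fun a => Zgen k q n r (row a) (col (σ a))).prod

/-- There are `N` pairwise anticommuting operators with squares `±1` acting irreducibly on a vector
space of dimension `2 ^ ⌊N / 2⌋` (the spin representation of a Clifford algebra). -/
theorem exists_irreducible_anticommuting (k : Type) [Field k] [NeZero (2 : k)] (N : ℕ) :
    ∃ (V : Type) (_ : AddCommGroup V) (_ : Module k V) (g : ℕ → Module.End k V),
      (∀ i < N, ∀ j < N, i ≠ j → g i * g j = -(g j * g i)) ∧
      (∀ i < N, g i * g i = 1 ∨ g i * g i = -1) ∧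
      (∀ W : Submodule k V, (∀ i < N, ∀ w ∈ W, g i w ∈ W) → W = ⊥ ∨ W = ⊤) ∧
      Module.Finite k V ∧ Module.finrank k V = 2 ^ (N / 2) := by
  induction N using Nat.twoStepInduction with
  | zero =>
    exact ⟨k, inferInstance, inferInstance, fun _ => 1, by simp, by simp,
      fun W _ => eq_bot_or_eq_top (α := Ideal k) W, inferInstance, by simp⟩
  | one =>
    exact ⟨k, inferInstance, inferInstance, fun _ => 1, by omega, by simp,
      fun W _ => eq_bot_or_eq_top (α := Ideal k) W, inferInstance, by simp⟩
  | more N ih _ =>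
    obtain ⟨V, _, _, g, hanti, hsq, hirr, hfin, hdim⟩ := ih
    let X : Module.End k (V × V) := (LinearMap.snd k V V).prod (LinearMap.fst k V V)
    let Y : Module.End k (V × V) := (-LinearMap.snd k V V).prod (LinearMap.fst k V V)
    let S : Module.End k V → Module.End k (V × V) := fun a => a.prodMap (-a)
    have hX (p : V × V) : X p = (p.2, p.1) := rfl
    have hY (p : V × V) : Y p = (-p.2, p.1) := rfl
    have hS (a : Module.End k V) (p : V × V) : S a p = (a p.1, -a p.2) := rfl
    have hXY : X * Y = -(Y * X) := by
      refine LinearMap.ext fun p => ?_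
      simp [hX, hY]
    have hXS (a) : X * S a = -(S a * X) := by
      refine LinearMap.ext fun p => ?_
      simp [hX, hS]
    have hYS (a) : Y * S a = -(S a * Y) := by
      refine LinearMap.ext fun p => ?_
      simp [hY, hS]
    refine ⟨V × V, inferInstance, inferInstance,
      fun i => match i with
        | 0 => X
        | 1 => Y
        | i + 2 => S (g i), ?_, ?_, ?_, inferInstance, ?_⟩
    · rintro (_ | _ | i) hi (_ | _ | j) hj hij
      · exact absurd rfl hij
      · exact hXY
      · exact hXS _
      · exact (neg_eq_iff_eq_neg.mpr hXY).symm
      · exact absurd rfl hij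
      · exact hYS _
      · exact (neg_eq_iff_eq_neg.mpr (hXS _)).symm
      · exact (neg_eq_iff_eq_neg.mpr (hYS _)).symm
      · have h := hanti i (by omega) j (by omega) (by omega)
        have h' (v : V) : g i (g j v) = -g j (g i v) := LinearMap.congr_fun h v
        refine LinearMap.ext fun p => ?_
        simp [hS, h']
    · rintro (_ | _ | i) hi
      · exact Or.inl (LinearMap.ext fun p => by simp [hX])
      · exact Or.inr (LinearMap.ext fun p => by simp [hY, Prod.ext_iff])
      · refine (hsq i (by omega)).imp (fun h => ?_) fun h => ?_
        all_goals
          have h' (v : V) := LinearMap.congr_fun h v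
          refine LinearMap.ext fun p => ?_
          simp only [Module.End.mul_apply, LinearMap.neg_apply, Module.End.one_apply] at h'
          simp [hS, h', Prod.ext_iff]
    · intro W hW
      have hWX (x y : V) (h : (x, y) ∈ W) : (y, x) ∈ W := hW 0 (by omega) _ h
      have hWY (x y : V) (h : (x, y) ∈ W) : (-y, x) ∈ W := hW 1 (by omega) _ h
      have hWl (x y : V) (h : (x, y) ∈ W) : (x, 0) ∈ W := by
        have h2 := W.smul_mem (2 : k)⁻¹ (W.add_mem h (hWX _ _ (hWY _ _ h)))
        have hx : (2 : k)⁻¹ • (x + x) = x := by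
          rw [← two_smul k x, inv_smul_smul₀ (NeZero.ne _)]
        simpa [hx] using h2
      rcases hirr (W.comap (LinearMap.inl k V V)) (fun i hi x hx => by
        have h := hW (i + 2) (by omega) _ hx
        simpa [hS] using h) with h | h
      · refine Or.inl ((Submodule.eq_bot_iff _).mpr fun ⟨x, y⟩ hxy => ?_)
        have key (z : V) (hz : (z, (0 : V)) ∈ W) : z = 0 :=
          (Submodule.eq_bot_iff _).mp h z hz
        rw [key x (hWl _ _ hxy), key y (hWl _ _ (hWX _ _ hxy))]
        rfl
      · refine Or.inr ((Submodule.eq_top_iff').mpr fun ⟨x, y⟩ => ?_)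
        have key (z : V) : (z, (0 : V)) ∈ W := (Submodule.eq_top_iff').mp h z
        simpa using W.add_mem (key x) (hWX _ _ (key y))
    · rw [Module.finrank_prod, hdim, show (N + 2) / 2 = N / 2 + 1 by omega, pow_succ, mul_two]

/-- An action of the generators of `M_{-1}(n,r)` in which generators sharing a row or a column
anticommute and all other pairs commute extends to an action of the whole algebra. -/
theorem exists_algHom_QMat_neg_one {k : Type} [Field k] {n r : ℕ} {A : Type} [Ring A] [Algebra k A]
    (z : Fin n → Fin r → A)
    (hrow : ∀ i j l, j < l → z i j * z i l = -(z i l * z i j))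
    (hcol : ∀ i s j, i < s → z i j * z s j = -(z s j * z i j))
    (hcomm : ∀ i s j l, i < s → j ≠ l → z i j * z s l = z s l * z i j) :
    ∃ φ : QMat k (-1 : k) n r →ₐ[k] A, ∀ i j, φ (Zgen k (-1) n r i j) = z i j := by
  refine ⟨RingQuot.liftAlgHom k ⟨FreeAlgebra.lift k fun p => z p.1 p.2, ?_⟩, fun i j => ?_⟩
  · rintro _ _ (⟨i, j, l, h⟩ | ⟨i, s, j, h⟩ | ⟨i, s, j, l, h, h'⟩ | ⟨i, s, j, l, h, h'⟩)
    · simpa using hrow i j l h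
    · simpa using hcol i s j h
    · simpa using hcomm i s j l h h'.ne'
    · simpa [inv_neg] using hcomm i s j l h h'.ne
  · simp [Zgen]

/-- Anticommutation inside a right-associated product. -/
theorem mul_mul_eq_neg_of_anticommute {A : Type} [Ring A] {x y : A} (h : x * y = -(y * x)) (z : A) :
    x * (y * z) = -(y * (x * z)) := by
  rw [← mul_assoc, h, neg_mul, mul_assoc]

/-- Given pairwise anticommuting `f j` and `e i`, the products `e i * f j` for `i ≠ 0`, together with
the `f j` in row `0`, satisfy the sign relations of `M_{-1}(n,r)`. -/
theorem exists_algHom_QMat_neg_one_of_anticommuting {k : Type} [Field k] {n r : ℕ} {A : Type}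
    [Ring A] [Algebra k A] (g : ℕ → A)
    (hanti : ∀ i < n + r - 1, ∀ j < n + r - 1, i ≠ j → g i * g j = -(g j * g i)) :
    ∃ φ : QMat k (-1 : k) n r →ₐ[k] A, ∀ i j, φ (Zgen k (-1) n r i j) =
      if i.val = 0 then g j else g (r + i - 1) * g j := by
  refine exists_algHom_QMat_neg_one _ (fun i j l h => ?_) (fun i s j h => ?_)
    fun i s j l h h' => ?_
  · have hjl := hanti j (by have := i.isLt; omega) l (by have := i.isLt; omega) (by omega)
    split_ifs with hi
    · exact hjl
    · have hj := hanti j (by omega) (r + i - 1) (by omega) (by omega)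
      have hl := hanti l (by omega) (r + i - 1) (by omega) (by omega)
      simp only [mul_assoc, hjl, mul_neg, neg_neg,
        mul_mul_eq_neg_of_anticommute hj, mul_mul_eq_neg_of_anticommute hl]
  · have hs := hanti j (by omega) (r + s - 1) (by omega) (by omega)
    rw [if_neg (show ¬ s.val = 0 by omega)]
    split_ifs with hi
    · simp only [mul_assoc, mul_mul_eq_neg_of_anticommute hs]
    · have hj := hanti j (by omega) (r + i - 1) (by omega) (by omega)
      have his := hanti (r + i - 1) (by omega) (r + s - 1) (by omega) (by omega)
      simp only [mul_assoc, mul_neg, neg_neg,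
        mul_mul_eq_neg_of_anticommute hs, mul_mul_eq_neg_of_anticommute hj, mul_mul_eq_neg_of_anticommute his]
  · have hjl := hanti j (by omega) l (by omega) (by omega)
    have hjs := hanti j (by omega) (r + s - 1) (by omega) (by omega)
    rw [if_neg (show ¬ s.val = 0 by omega)]
    split_ifs with hi
    · simp only [mul_assoc, hjl, mul_neg, neg_neg, mul_mul_eq_neg_of_anticommute hjs]
    · have hli := hanti l (by omega) (r + i - 1) (by omega) (by omega)
      have his := hanti (r + i - 1) (by omega) (r + s - 1) (by omega) (by omega)
      simp only [mul_assoc, hjl, mul_neg, neg_neg,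
        mul_mul_eq_neg_of_anticommute hjs, mul_mul_eq_neg_of_anticommute hli,
        mul_mul_eq_neg_of_anticommute his]

/-- Let `k` be algebraically closed of characteristic zero and
`q = -1`.  Then `M_q(n,r)` has a finite-dimensional irreducible module of dimension
`2 ^ ⌊(n + r - 1)/2⌋`. -/
theorem exists_simple_module_QMat_neg_one
    (k : Type) [Field k] [IsAlgClosed k] [CharZero k] (n r : ℕ)
    (hr : 1 ≤ r) (hrn : r ≤ n) :
    ∃ (V : Type) (_ : AddCommGroup V) (_ : Module k V)
      (_ : Module (QMat k (-1 : k) n r) V) (_ : IsScalarTower k (QMat k (-1 : k) n r) V),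
      IsSimpleModule (QMat k (-1 : k) n r) V ∧ Module.Finite k V ∧
        Module.finrank k V = 2 ^ ((n + r - 1) / 2) := by
  obtain ⟨V, _, _, g, hanti, hsq, hirr, hfin, hdim⟩ :=
    exists_irreducible_anticommuting k (n + r - 1)
  obtain ⟨φ, hφ⟩ := exists_algHom_QMat_neg_one_of_anticommuting (k := k) g hanti
  let _ : Module (QMat k (-1 : k) n r) V := Module.compHom V φ.toRingHom
  have hsmul (a : QMat k (-1 : k) n r) (v : V) : a • v = φ a v := rfl
  have htower : IsScalarTower k (QMat k (-1 : k) n r) V :=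
    ⟨fun c a v => by rw [hsmul, hsmul, map_smul, LinearMap.smul_apply]⟩
  have hnt : Nontrivial V := Module.nontrivial_of_finrank_pos (R := k) (by rw [hdim]; positivity)
  refine ⟨V, inferInstance, inferInstance, inferInstance, htower, ?_, hfin, hdim⟩
  rw [isSimpleModule_iff]
  refine { eq_bot_or_eq_top := fun W => ?_ }
  have hz (i : Fin n) (j : Fin r) (w : V) (hw : w ∈ W) :
      (if i.val = 0 then g j else g (r + i - 1) * g j) w ∈ W := by
    rw [← hφ, ← hsmul]
    exact W.smul_mem _ hw
  have hlow (j : ℕ) (hj : j < r) (w : V) (hw : w ∈ W) : g j w ∈ W := by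
    simpa using hz ⟨0, by omega⟩ ⟨j, hj⟩ w hw
  have hinv : ∀ i < n + r - 1, ∀ w ∈ W.restrictScalars k, g i w ∈ W.restrictScalars k := by
    intro i hi w hw
    rw [Submodule.restrictScalars_mem] at hw ⊢
    by_cases hir : i < r
    · exact hlow i hir w hw
    · have h := hz ⟨i + 1 - r, by omega⟩ ⟨0, hr⟩ _ (hlow 0 hr w hw)
      rw [if_neg (show ¬ i + 1 - r = 0 by omega),
        show r + (i + 1 - r) - 1 = i by omega, Module.End.mul_apply] at h
      rcases hsq 0 (by omega) with h0 | h0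
      all_goals
        have h0' := LinearMap.congr_fun h0 w
        simp only [Module.End.mul_apply, LinearMap.neg_apply, Module.End.one_apply] at h0'
        simpa [h0'] using h
  exact (hirr _ hinv).imp (Submodule.restrictScalars_eq_bot_iff k _ _).mp
    (Submodule.restrictScalars_eq_top_iff k _ _).mp
end

section
/- For n ≥ r ≥ 1, in any block diagonal form of the defining matrix J of M̄_q(n,r), every non-trivial 2×2 block is of the form ((0,d),(−d,0)) with d ∈ {1, 2, 4}. -/
open scoped BigOperators

/-- The `k × k` integer matrix `H_k = Σ_{1 ≤ j < i ≤ k} (E_{i,j} - E_{j,i})`. -/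
def HmatZ (k : ℕ) : Matrix (Fin k) (Fin k) ℤ :=
  Matrix.of fun i j => if (j : ℕ) < (i : ℕ) then 1 else if (i : ℕ) < (j : ℕ) then -1 else 0

/-- The defining matrix `J` of the quasipolynomial algebra `M̄_q(n,r)`: the skew-symmetric
`nr × nr` integer matrix of the linear map `A ↦ H_n A - A H_r` on `n × r` matrices in the
basis of matrix units, i.e. `J ((i,j),(s,t)) = (H_n)_{i,s} δ_{j,t} - δ_{i,s} (H_r)_{t,j}`. -/
def Jdef (n r : ℕ) : Matrix (Fin n × Fin r) (Fin n × Fin r) ℤ :=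
  Matrix.of fun p q =>
    HmatZ n p.1 q.1 * (if p.2 = q.2 then 1 else 0) -
      (if p.1 = q.1 then 1 else 0) * HmatZ r q.2 p.2

/-- The `N × N` skew-symmetric block diagonal matrix with `2 × 2` blocks
`((0, d i), (-d i, 0))` for `i = 0, ..., p-1` (occupying the index pairs
`(2i, 2i+1)`), and zeros elsewhere. -/
def blockSkew (N p : ℕ) (d : Fin p → ℤ) : Matrix (Fin N) (Fin N) ℤ :=
  Matrix.of fun a b =>
    if h : (a : ℕ) % 2 = 0 ∧ (b : ℕ) = (a : ℕ) + 1 ∧ (a : ℕ) / 2 < p then d ⟨(a : ℕ) / 2, h.2.2⟩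
    else if h' : (b : ℕ) % 2 = 0 ∧ (a : ℕ) = (b : ℕ) + 1 ∧ (b : ℕ) / 2 < p then
      -d ⟨(b : ℕ) / 2, h'.2.2⟩
    else 0

/-- `blockSkew (n*r) p d` is a block diagonal form of the skew-symmetric matrix `J`:
there is a matrix `U`, invertible over `ℤ`, with `U * J * Uᵀ = blockSkew (n*r) p d`,
where the `p` non-trivial blocks are `((0, d i), (-d i, 0))` with `d i ≥ 1`, followed by
a zero block. -/
def IsBlockForm (n r p : ℕ) (d : Fin p → ℤ) : Prop :=
  2 * p ≤ n * r ∧ (∀ i, 1 ≤ d i) ∧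
    ∃ (U : Matrix (Fin (n * r)) (Fin n × Fin r) ℤ)
      (V : Matrix (Fin n × Fin r) (Fin (n * r)) ℤ),
      U * V = 1 ∧ V * U = 1 ∧ U * Jdef n r * U.transpose = blockSkew (n * r) p d

/-- The corank `c_{n,r}` of the defining matrix `J` of `M̄_q(n,r)`:
`c_{n,r} = gcd(n,r)` if both `n/gcd(n,r)` and `r/gcd(n,r)` are odd, and `0` otherwise. -/
def corankJ (n r : ℕ) : ℕ :=
  if Odd (n / Nat.gcd n r) ∧ Odd (r / Nat.gcd n r) then Nat.gcd n r else 0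

/-- The sign carried by row `i` of the negacyclic shift. -/
def negacyclicSign {k : ℕ} (i : Fin (k + 1)) : ℤ := if i = 0 then -1 else 1

/-- The negacyclic shift matrix `P`, a signed permutation matrix with `P ^ (k + 1) = -1`. -/
def negacyclic (k : ℕ) : Matrix (Fin (k + 1)) (Fin (k + 1)) ℤ :=
  Matrix.of fun i j => if j = i - 1 then negacyclicSign i else 0

theorem negacyclic_mul_apply {k : ℕ} {β : Type*} (A : Matrix (Fin (k + 1)) β ℤ)
    (i : Fin (k + 1)) (j : β) :
    (negacyclic k * A) i j = negacyclicSign i * A (i - 1) j := by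
  simp [negacyclic, Matrix.mul_apply]

theorem mul_negacyclic_apply {k : ℕ} {α : Type*} (A : Matrix α (Fin (k + 1)) ℤ)
    (i : α) (j : Fin (k + 1)) :
    (A * negacyclic k) i j = negacyclicSign (j + 1) * A i (j + 1) := by
  simp only [negacyclic, Matrix.mul_apply, Matrix.of_apply, eq_sub_iff_add_eq]
  simp [mul_comm]

/-- `H` is the Cayley transform of the negacyclic shift. -/
theorem one_sub_negacyclic_mul_HmatZ (k : ℕ) :
    (1 - negacyclic k) * HmatZ (k + 1) = 1 + negacyclic k := by
  ext i j
  rw [sub_mul, one_mul, Matrix.sub_apply, negacyclic_mul_apply, Matrix.add_apply,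
    Matrix.one_apply]
  simp only [HmatZ, negacyclic, negacyclicSign, Matrix.of_apply, Fin.ext_iff, Fin.coe_sub_one,
    Fin.val_zero]
  grind

theorem HmatZ_mul_one_sub_negacyclic (k : ℕ) :
    HmatZ (k + 1) * (1 - negacyclic k) = 1 + negacyclic k := by
  ext i j
  rw [mul_sub, mul_one, Matrix.sub_apply, mul_negacyclic_apply, Matrix.add_apply,
    Matrix.one_apply]
  simp only [HmatZ, negacyclic, negacyclicSign, Matrix.of_apply, Fin.ext_iff, Fin.coe_sub_one,
    Fin.val_add_one, Fin.val_zero, Fin.val_last]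
  grind

/-- An odd function on `ℤ` that depends only on `a` modulo `m` and is congruent to `2 * a`. -/
def oddLift (m a : ℤ) : ℤ := a % m - (-a) % m

theorem oddLift_sign_mul {k : ℕ} (m a : ℤ) (i : Fin (k + 1)) :
    oddLift m (negacyclicSign i * a) = negacyclicSign i * oddLift m a := by
  unfold oddLift negacyclicSign
  split_ifs <;> simp

theorem oddLift_congr {m a b : ℤ} (h : m ∣ a - b) : oddLift m a = oddLift m b := by
  have h1 : a % m = b % m := Int.emod_eq_emod_iff_emod_sub_eq_zero.mpr (Int.emod_eq_zero_of_dvd h)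
  have h2 : (-a) % m = (-b) % m :=
    Int.emod_eq_emod_iff_emod_sub_eq_zero.mpr (Int.emod_eq_zero_of_dvd (by
      rwa [neg_sub_neg, dvd_sub_comm]))
  rw [oddLift, oddLift, h1, h2]

theorem dvd_two_mul_sub_oddLift (m a : ℤ) : m ∣ 2 * a - oddLift m a := by
  have h1 := Int.dvd_self_sub_emod (x := a) (m := m)
  have h2 := Int.dvd_self_sub_emod (x := -a) (m := m)
  have h := dvd_sub h1 h2
  unfold oddLift
  exact (show a - a % m - (-a - -a % m) = 2 * a - (a % m - -a % m) by ring) ▸ h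

/-- The torsion of the cokernel of `A ↦ P * A - A * Q` is killed by `2`. -/
theorem exists_negacyclic_commutator_eq_two_smul {k l : ℕ} {m : ℤ} (hm : m ≠ 0)
    {W A : Matrix (Fin (k + 1)) (Fin (l + 1)) ℤ}
    (h : negacyclic k * A - A * negacyclic l = m • W) :
    ∃ C : Matrix (Fin (k + 1)) (Fin (l + 1)) ℤ,
      negacyclic k * C - C * negacyclic l = (2 : ℤ) • W := by
  choose c hc using fun a : ℤ => dvd_two_mul_sub_oddLift m a
  refine ⟨A.map c, ?_⟩
  ext i j
  have hij := congrFun (congrFun h i) j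
  simp only [Matrix.sub_apply, negacyclic_mul_apply, mul_negacyclic_apply, Matrix.smul_apply,
    smul_eq_mul, Matrix.map_apply] at hij ⊢
  have hf := oddLift_congr (Dvd.intro _ hij.symm)
  rw [oddLift_sign_mul, oddLift_sign_mul] at hf
  refine mul_left_cancel₀ hm ?_
  linear_combination 2 * hij - negacyclicSign i * hc (A (i - 1) j) +
    negacyclicSign (j + 1) * hc (A i (j + 1)) - hf

/-- Multiplication by `1 - P` on the left and by `1 - Q` on the right is injective. -/
theorem one_sub_negacyclic_mul_mul_injective (k l : ℕ) :
    Function.Injective fun X : Matrix (Fin (k + 1)) (Fin (l + 1)) ℤ =>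
      (1 - negacyclic k) * X * (1 - negacyclic l) := by
  have hP : (1 + HmatZ (k + 1)) * (1 - negacyclic k) = (2 : ℤ) • 1 := by
    rw [add_mul, HmatZ_mul_one_sub_negacyclic, one_mul, two_smul]
    abel
  have hQ : (1 - negacyclic l) * (1 + HmatZ (l + 1)) = (2 : ℤ) • 1 := by
    rw [mul_add, one_sub_negacyclic_mul_HmatZ, mul_one, two_smul]
    abel
  have key (X : Matrix (Fin (k + 1)) (Fin (l + 1)) ℤ) :
      (1 + HmatZ (k + 1)) * ((1 - negacyclic k) * X * (1 - negacyclic l)) *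
        (1 + HmatZ (l + 1)) = (4 : ℤ) • X := by
    calc _ = ((1 + HmatZ (k + 1)) * (1 - negacyclic k)) * X *
          ((1 - negacyclic l) * (1 + HmatZ (l + 1))) := by simp only [Matrix.mul_assoc]
      _ = _ := by
        rw [hP, hQ, Matrix.smul_mul, Matrix.one_mul, Matrix.mul_smul, Matrix.mul_one, smul_smul]
        norm_num
  intro X Y hXY
  have h4 : (4 : ℤ) • X = (4 : ℤ) • Y := by
    rw [← key X, ← key Y]
    exact congrArg (fun Z => (1 + HmatZ (k + 1)) * Z * (1 + HmatZ (l + 1))) hXY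
  exact smul_right_injective _ (by norm_num) h4

theorem one_sub_negacyclic_mul_commutator_mul {k l : ℕ}
    (A : Matrix (Fin (k + 1)) (Fin (l + 1)) ℤ) :
    (1 - negacyclic k) * (HmatZ (k + 1) * A - A * HmatZ (l + 1)) * (1 - negacyclic l) =
      (2 : ℤ) • (negacyclic k * A - A * negacyclic l) := by
  calc _ = ((1 - negacyclic k) * HmatZ (k + 1)) * A * (1 - negacyclic l) -
        (1 - negacyclic k) * A * (HmatZ (l + 1) * (1 - negacyclic l)) := by
        rw [Matrix.mul_sub _ (_ * _), Matrix.sub_mul (_ * _)]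
        simp only [Matrix.mul_assoc]
    _ = _ := by
      rw [one_sub_negacyclic_mul_HmatZ, HmatZ_mul_one_sub_negacyclic]
      simp only [Matrix.mul_sub, Matrix.sub_mul, Matrix.mul_add, Matrix.add_mul, Matrix.one_mul,
        Matrix.mul_one, two_smul]
      abel

/-- The torsion of the cokernel of `A ↦ H * A - A * H` is killed by `4`. -/
theorem exists_HmatZ_commutator_eq_four_smul {k l : ℕ} {m : ℤ} (hm : m ≠ 0)
    {W A : Matrix (Fin (k + 1)) (Fin (l + 1)) ℤ}
    (h : HmatZ (k + 1) * A - A * HmatZ (l + 1) = m • W) :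
    ∃ C : Matrix (Fin (k + 1)) (Fin (l + 1)) ℤ,
      HmatZ (k + 1) * C - C * HmatZ (l + 1) = (4 : ℤ) • W := by
  have h2 : negacyclic k * ((2 : ℤ) • A) - ((2 : ℤ) • A) * negacyclic l =
      m • ((1 - negacyclic k) * W * (1 - negacyclic l)) := by
    rw [Matrix.mul_smul, Matrix.smul_mul, ← smul_sub, ← one_sub_negacyclic_mul_commutator_mul, h,
      Matrix.mul_smul, Matrix.smul_mul]
  obtain ⟨C, hC⟩ := exists_negacyclic_commutator_eq_two_smul hm h2
  refine ⟨C, one_sub_negacyclic_mul_mul_injective k l ?_⟩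
  simp only [one_sub_negacyclic_mul_commutator_mul, hC, Matrix.mul_smul, Matrix.smul_mul,
    smul_smul]
  norm_num

theorem Jdef_mulVec_apply (n r : ℕ) (A : Matrix (Fin n) (Fin r) ℤ) (q : Fin n × Fin r) :
    (Jdef n r).mulVec (fun q => A q.1 q.2) q = (HmatZ n * A - A * HmatZ r) q.1 q.2 := by
  simp only [Matrix.mulVec, dotProduct, Jdef, Matrix.of_apply, Fintype.sum_prod_type,
    Matrix.sub_apply, Matrix.mul_apply, sub_mul, Finset.sum_sub_distrib]
  congr 1
  · simp
  · rw [Finset.sum_comm]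
    simp [mul_comm]

theorem exists_Jdef_mulVec_eq_four_smul {n r : ℕ} (hn : 1 ≤ n) (hr : 1 ≤ r) {m : ℤ} (hm : m ≠ 0)
    {w v : Fin n × Fin r → ℤ} (h : (Jdef n r).mulVec v = m • w) :
    ∃ u : Fin n × Fin r → ℤ, (Jdef n r).mulVec u = (4 : ℤ) • w := by
  obtain ⟨k, rfl⟩ := Nat.exists_eq_add_of_le' hn
  obtain ⟨l, rfl⟩ := Nat.exists_eq_add_of_le' hr
  obtain ⟨C, hC⟩ := exists_HmatZ_commutator_eq_four_smul (k := k) (l := l) hm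
    (W := Matrix.of fun i j => w (i, j)) (A := Matrix.of fun i j => v (i, j)) (by
      ext i j
      exact (Jdef_mulVec_apply _ _ _ (i, j)).symm.trans (congrFun h (i, j)))
  refine ⟨fun q => C q.1 q.2, ?_⟩
  ext q
  rw [Jdef_mulVec_apply, hC]
  rfl

/-- For `n ≥ r ≥ 1`, in any block diagonal form of the defining matrix
`J` of `M̄_q(n,r)`, every non-trivial `2 × 2` block is `((0,d),(-d,0))` with
`d ∈ {1, 2, 4}`. -/
theorem blocks_of_Jdef_mem
    (n r : ℕ) (hr : 1 ≤ r) (hrn : r ≤ n) (p : ℕ) (d : Fin p → ℤ)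
    (hform : IsBlockForm n r p d) :
    ∀ i : Fin p, d i = 1 ∨ d i = 2 ∨ d i = 4 := by
  obtain ⟨hp, hd, U, V, hUV, hVU, hJ⟩ := hform
  intro i
  have hi := i.isLt
  have hdi := hd i
  let a : Fin (n * r) := ⟨2 * i, by omega⟩
  let b : Fin (n * r) := ⟨2 * i + 1, by omega⟩
  have hcol (c : Fin (n * r)) : blockSkew (n * r) p d c b = if c = a then d i else 0 := by
    simp only [blockSkew, Matrix.of_apply, a, b, Fin.ext_iff]
    grind
  have hrow (c : Fin (n * r)) : blockSkew (n * r) p d a c = if c = b then d i else 0 := by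
    simp only [blockSkew, Matrix.of_apply, a, b, Fin.ext_iff]
    grind
  have hVUT : U.transpose * V.transpose = 1 := by
    rw [← Matrix.transpose_mul, hVU, Matrix.transpose_one]
  have h : (Jdef n r).mulVec (U.transpose.col b) = d i • V.col a := by
    have hJU : Jdef n r * U.transpose = V * blockSkew (n * r) p d := by
      rw [← hJ, ← Matrix.mul_assoc, ← Matrix.mul_assoc, hVU, Matrix.one_mul]
    ext q
    have hq := congrFun (congrFun hJU q) b
    simp only [Matrix.mul_apply, hcol] at hq
    simpa [Matrix.mulVec, dotProduct, mul_comm] using hq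
  obtain ⟨u, hu⟩ := exists_Jdef_mulVec_eq_four_smul (hr.trans hrn) hr (by omega) h
  have hdvd : d i ∣ 4 := by
    have hUJ : U * Jdef n r = blockSkew (n * r) p d * V.transpose := by
      rw [← hJ, Matrix.mul_assoc _ _ V.transpose, hVUT, Matrix.mul_one]
    have h4 : (blockSkew (n * r) p d).mulVec (V.transpose.mulVec u) a = 4 := by
      rw [Matrix.mulVec_mulVec, ← hUJ, ← Matrix.mulVec_mulVec, hu, Matrix.mulVec_smul]
      have := congrFun (congrFun hUV a) a
      rw [Matrix.mul_apply, Matrix.one_apply_eq] at this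
      simp [Matrix.mulVec, dotProduct, this]
    rw [← h4]
    refine ⟨V.transpose.mulVec u b, ?_⟩
    rw [Matrix.mulVec, dotProduct]
    simp [hrow]
  have hle := Int.le_of_dvd (by norm_num) hdvd
  generalize d i = e at *
  interval_cases e <;> simp_all
end

section
/- For n ≥ r ≥ 1, the defining matrix J of M̄_q(n,r) has a block diagonal form consisting of exactly d_0 = ⌊(n+r−1)/2⌋ blocks ((0,1),(−1,0)), exactly max{0, (nr − c_{n,r})/2 − d_0} blocks of the form ((0,2),(−2,0)) or ((0,4),(−4,0)), and a zero block of size c_{n,r}, where c_{n,r} is the corank of J (c_{n,r} = gcd(n,r) if both n/gcd(n,r) and r/gcd(n,r) are odd, and c_{n,r} = 0 otherwise). -/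
open scoped BigOperators

theorem blockSkew_zero_block (N : ℕ) (d : Fin 0 → ℤ) : blockSkew N 0 d = 0 := by
  ext a b
  simp [blockSkew]

theorem blockSkew_succ_succ (N p : ℕ) (d₀ : ℤ) (d : Fin p → ℤ) (a b : Fin N) :
    blockSkew (N + 2) (p + 1) (Fin.cons d₀ d) a.succ.succ b.succ.succ = blockSkew N p d a b := by
  have key : ∀ (k : ℕ) (h : (k + 1 + 1) / 2 < p + 1) (h' : k / 2 < p),
      (Fin.cons d₀ d : Fin (p + 1) → ℤ) ⟨(k + 1 + 1) / 2, h⟩ = d ⟨k / 2, h'⟩ := by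
    intro k h h'
    have : (⟨(k + 1 + 1) / 2, h⟩ : Fin (p + 1)) = Fin.succ ⟨k / 2, h'⟩ := by
      ext; simp; omega
    rw [this, Fin.cons_succ]
  simp only [blockSkew, Matrix.of_apply, Fin.val_succ]
  split_ifs <;> first | omega | rfl | skip
  · rw [key]
  · rw [key]

theorem blockSkew_zero_one (N p : ℕ) (d : Fin (p + 1) → ℤ) :
    blockSkew (N + 2) (p + 1) d 0 1 = d 0 := by
  simp [blockSkew]

theorem blockSkew_zero_succ_succ (N p : ℕ) (d : Fin (p + 1) → ℤ) (b : Fin N) :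
    blockSkew (N + 2) (p + 1) d 0 b.succ.succ = 0 := by
  simp [blockSkew]

theorem blockSkew_one_succ_succ (N p : ℕ) (d : Fin (p + 1) → ℤ) (b : Fin N) :
    blockSkew (N + 2) (p + 1) d 1 b.succ.succ = 0 := by
  simp [blockSkew]

theorem blockSkew_swap (N p : ℕ) (d : Fin p → ℤ) (a b : Fin N) :
    blockSkew N p d a b = -blockSkew N p d b a := by
  simp only [blockSkew, Matrix.of_apply]
  split_ifs <;> omega

/-- For an alternating integral form, the least positive value `B u v` divides every `B u w`. -/
theorem dvd_apply_of_minimal {V : Type*} [AddCommGroup V] (B : V →ₗ[ℤ] V →ₗ[ℤ] ℤ) {u v : V}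
    (hpos : 0 < B u v) (hmin : ∀ x y, 0 < B x y → B u v ≤ B x y) (w : V) : B u v ∣ B u w := by
  by_contra h
  have h1 : B u (w - (B u w / B u v) • v) = B u w % B u v := by
    rw [map_sub, map_smul, smul_eq_mul, Int.emod_def, mul_comm]
  have h2 : 0 < B u w % B u v :=
    lt_of_le_of_ne (Int.emod_nonneg _ hpos.ne') fun e => h (Int.dvd_of_emod_eq_zero e.symm)
  have h3 := hmin u _ (h1 ▸ h2)
  rw [h1] at h3
  exact absurd (Int.emod_lt_of_pos (B u w) hpos) (not_lt.mpr h3)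

theorem exists_minimal_pos {V : Type*} [AddCommGroup V] (B : V →ₗ[ℤ] V →ₗ[ℤ] ℤ) (hB : B ≠ 0) :
    ∃ u v, 0 < B u v ∧ ∀ x y, 0 < B x y → B u v ≤ B x y := by
  have hne : ∃ m : ℕ, ∃ u v, 0 < B u v ∧ B u v = m := by
    obtain ⟨u, v, h⟩ : ∃ u v, B u v ≠ 0 := by
      by_contra! h
      exact hB (LinearMap.ext₂ h)
    rcases lt_or_gt_of_ne h with h | h
    · exact ⟨(B u (-v)).toNat, u, -v, by simpa using h, by simp; omega⟩
    · exact ⟨(B u v).toNat, u, v, h, by omega⟩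
  classical
  obtain ⟨u, v, h, hm⟩ := Nat.find_spec hne
  refine ⟨u, v, h, fun x y hxy => ?_⟩
  have := Nat.find_min' hne ⟨x, y, hxy, (Int.toNat_of_nonneg hxy.le).symm⟩
  omega

open Module in
/-- Every alternating form on a finite free `ℤ`-module has a basis in which its Gram matrix is
block diagonal with skew `2 × 2` blocks followed by zeros. -/
theorem exists_basis_eq_blockSkew (N : ℕ) : ∀ (V : Type) [AddCommGroup V] [Module.Free ℤ V]
    [Module.Finite ℤ V] (B : V →ₗ[ℤ] V →ₗ[ℤ] ℤ), B.IsAlt → finrank ℤ V = N →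
    ∃ (p : ℕ) (d : Fin p → ℤ) (b : Basis (Fin N) ℤ V), 2 * p ≤ N ∧ (∀ i, 1 ≤ d i) ∧
      ∀ i j, B (b i) (b j) = blockSkew N p d i j := by
  induction N using Nat.strong_induction_on with
  | _ N ih =>
  intro V _ _ _ B hB hN
  by_cases h0 : B = 0
  · exact ⟨0, Fin.elim0, finBasisOfFinrankEq ℤ V hN, by simp, fun i => i.elim0,
      fun i j => by simp [h0, blockSkew_zero_block]⟩
  obtain ⟨u, v, hpos, hmin⟩ := exists_minimal_pos B h0
  have hne : B u v ≠ 0 := hpos.ne'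
  have hvu : B v u = -B u v := (hB.neg u v).symm
  have hdvd : ∀ w, B u v ∣ B u w := dvd_apply_of_minimal B hpos hmin
  have hdvd' : ∀ w, B u v ∣ B v w := by
    intro w
    have hneg : B v (-u) = B u v := by rw [map_neg, hvu, neg_neg]
    have := dvd_apply_of_minimal B (u := v) (v := -u) (hneg ▸ hpos)
      (fun x y h => hneg ▸ hmin x y h) w
    rwa [hneg] at this
  let O : Submodule ℤ V := LinearMap.ker (B v)
  let W : Submodule ℤ V := LinearMap.ker (B u) ⊓ O
  have hWO : W ≤ O := inf_le_right
  have hvO : v ∈ O := hB v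
  let m := finrank ℤ W
  have hli₁ : ∀ (c : ℤ), ∀ x ∈ W, c • v + x = 0 → c = 0 := by
    intro c x hx h
    have := congrArg (B u) h
    have hx' : B u x = 0 := hx.1
    simpa [hx', hne] using this
  have hsp₁ : ∀ z ∈ O, ∃ c : ℤ, z + c • v ∈ W := by
    intro z hz
    obtain ⟨k, hk⟩ := hdvd z
    refine ⟨-k, ?_, ?_⟩
    · simp [hk, mul_comm]
    · exact O.add_mem hz (O.smul_mem _ hvO)
  have hli₂ : ∀ (c : ℤ), ∀ x ∈ O, c • u + x = 0 → c = 0 := by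
    intro c x hx h
    have := congrArg (B v) h
    have hx' : B v x = 0 := hx
    simpa [hx', hne, hvu] using this
  have hsp₂ : ∀ z, ∃ c : ℤ, z + c • u ∈ O := by
    intro z
    obtain ⟨k, hk⟩ := hdvd' z
    exact ⟨k, by simp [O, hk, hvu, mul_comm]⟩
  have basis_of : ∀ bW : Basis (Fin m) ℤ W, ∃ b : Basis (Fin (m + 2)) ℤ V,
      b 0 = u ∧ b 1 = v ∧ ∀ i, b (Fin.succ (Fin.succ i)) = bW i := fun bW =>
    ⟨Basis.mkFinCons u (Basis.mkFinConsOfLE v hvO bW hWO hli₁ hsp₁) hli₂ hsp₂, by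
      simp, by
      rw [← Fin.succ_zero_eq_one]
      simp [Basis.coe_mkFinCons, Basis.coe_mkFinConsOfLE, -Fin.succ_zero_eq_one], by
      intro i
      simp [Basis.coe_mkFinCons, Basis.coe_mkFinConsOfLE]⟩
  have hm : N = m + 2 := by
    obtain ⟨b, -⟩ := basis_of (finBasis ℤ W)
    rw [← hN, finrank_eq_card_basis b, Fintype.card_fin]
  subst hm
  obtain ⟨p, d, bW, hp, hd, hbW⟩ := ih m (by omega) W (B.domRestrict₁₂ W W) (fun x => hB x) rfl
  obtain ⟨b, hb0, hb1, hb⟩ := basis_of bW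
  have hu : ∀ i, B u (bW i) = 0 := fun i => (bW i).2.1
  have hv : ∀ i, B v (bW i) = 0 := fun i => (bW i).2.2
  have hW : ∀ i j, B (bW i) (bW j) = blockSkew m p d i j := hbW
  refine ⟨p + 1, Fin.cons (B u v) d, b, by omega, ?_, ?_⟩
  · intro i
    refine Fin.cases ?_ ?_ i
    · exact hpos
    · simpa using hd
  · have hswap : ∀ i j,
        B (b j) (b i) = blockSkew (m + 2) (p + 1) (Fin.cons (B u v) d) j i →
        B (b i) (b j) = blockSkew (m + 2) (p + 1) (Fin.cons (B u v) d) i j := by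
      intro i j h
      rw [blockSkew_swap, ← h, hB.neg]
    have hdiag : ∀ i, B (b i) (b i) = blockSkew (m + 2) (p + 1) (Fin.cons (B u v) d) i i := by
      intro i
      have := blockSkew_swap (m + 2) (p + 1) (Fin.cons (B u v) d) i i
      rw [hB]
      omega
    have h01 : B (b 0) (b 1) = blockSkew (m + 2) (p + 1) (Fin.cons (B u v) d) 0 1 := by
      rw [blockSkew_zero_one, hb0, hb1, Fin.cons_zero]
    have h0 : ∀ k : Fin m, B (b 0) (b k.succ.succ) =
        blockSkew (m + 2) (p + 1) (Fin.cons (B u v) d) 0 k.succ.succ := fun k => by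
      rw [blockSkew_zero_succ_succ, hb0, hb, hu]
    have h1 : ∀ k : Fin m, B (b 1) (b k.succ.succ) =
        blockSkew (m + 2) (p + 1) (Fin.cons (B u v) d) 1 k.succ.succ := fun k => by
      rw [blockSkew_one_succ_succ, hb1, hb, hv]
    intro i j
    refine Fin.cases ?_ (fun i => Fin.cases ?_ (fun i => ?_) i) i <;>
      refine Fin.cases ?_ (fun j => Fin.cases ?_ (fun j => ?_) j) j
    · exact hdiag _
    · exact h01
    · exact h0 j
    · exact hswap _ _ h01
    · exact hdiag _
    · exact h1 j
    · exact hswap _ _ (h0 i)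
    · exact hswap _ _ (h1 i)
    · rw [blockSkew_succ_succ, hb, hb, hW]

open Module Matrix in
/-- Skew normal form of an integral skew-symmetric matrix. -/
theorem exists_mul_mul_transpose_eq_blockSkew {ι : Type} [Fintype ι] [DecidableEq ι] {N : ℕ}
    (hN : Fintype.card ι = N) (M : Matrix ι ι ℤ) (hM : Mᵀ = -M) :
    ∃ (p : ℕ) (d : Fin p → ℤ), 2 * p ≤ N ∧ (∀ i, 1 ≤ d i) ∧
      ∃ (U : Matrix (Fin N) ι ℤ) (V : Matrix ι (Fin N) ℤ),
        U * V = 1 ∧ V * U = 1 ∧ U * M * Uᵀ = blockSkew N p d := by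
  have hB : (Matrix.toLinearMap₂' ℤ M : (ι → ℤ) →ₗ[ℤ] (ι → ℤ) →ₗ[ℤ] ℤ).IsAlt := by
    intro x
    have h1 : x ⬝ᵥ M *ᵥ x = -(x ⬝ᵥ M *ᵥ x) := by
      conv_lhs => rw [dotProduct_mulVec, dotProduct_comm, ← mulVec_transpose, hM]
      simp [neg_mulVec]
    rw [Matrix.toLinearMap₂'_apply']
    omega
  obtain ⟨p, d, b, hp, hd, hb⟩ := exists_basis_eq_blockSkew N (ι → ℤ) (Matrix.toLinearMap₂' ℤ M)
    hB (by simp [hN])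
  let P := (Pi.basisFun ℤ ι).toMatrix b
  let Q := b.toMatrix (Pi.basisFun ℤ ι)
  have hPQ : P * Q = 1 := Basis.toMatrix_mul_toMatrix_flip _ _
  have hQP : Q * P = 1 := Basis.toMatrix_mul_toMatrix_flip _ _
  refine ⟨p, d, hp, hd, Pᵀ, Qᵀ, ?_, ?_, ?_⟩
  · rw [← transpose_mul, hQP, transpose_one]
  · rw [← transpose_mul, hPQ, transpose_one]
  · ext i j
    rw [← hb, Matrix.toLinearMap₂'_apply', Matrix.mul_assoc, Matrix.mul_apply]
    rfl

/-- The involution of `Fin N` exchanging `2 i` and `2 i + 1` for `i < p`. -/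
def blockSwap (N p : ℕ) (hp : 2 * p ≤ N) : Equiv.Perm (Fin N) :=
  Function.Involutive.toPerm
    (fun a => ⟨if (a : ℕ) / 2 < p then if (a : ℕ) % 2 = 0 then a + 1 else a - 1 else a, by
      split_ifs <;> omega⟩) (by
    intro a
    ext
    dsimp only
    split_ifs <;> omega)

theorem blockSwap_val (N p : ℕ) (hp : 2 * p ≤ N) (a : Fin N) :
    (blockSwap N p hp a : ℕ) =
      if (a : ℕ) / 2 < p then if (a : ℕ) % 2 = 0 then (a : ℕ) + 1 else (a : ℕ) - 1 else a :=
  rfl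

theorem blockSkew_eq_zero (N p : ℕ) (hp : 2 * p ≤ N) (d : Fin p → ℤ) {a b : Fin N}
    (h : b ≠ blockSwap N p hp a) : blockSkew N p d a b = 0 := by
  have h' : (b : ℕ) ≠ blockSwap N p hp a := fun e => h (Fin.ext e)
  rw [blockSwap_val] at h'
  simp only [blockSkew, Matrix.of_apply]
  split_ifs at h' ⊢ <;> omega

theorem blockSkew_blockSwap (N p : ℕ) (hp : 2 * p ≤ N) (d : Fin p → ℤ) (a : Fin N) :
    blockSkew N p d a (blockSwap N p hp a) =
      if h : (a : ℕ) / 2 < p then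
        if (a : ℕ) % 2 = 0 then d ⟨(a : ℕ) / 2, h⟩ else -d ⟨(a : ℕ) / 2, h⟩ else 0 := by
  simp only [blockSkew, Matrix.of_apply, blockSwap_val]
  split_ifs with h1 h2 h3 h4 h5 h6 <;> first | rfl | omega | skip
  congr 3
  omega

open Matrix in
theorem rank_blockSkew (K : Type*) [Field K] [DecidableEq K] (N p : ℕ) (hp : 2 * p ≤ N)
    (d : Fin p → ℤ) :
    ((blockSkew N p d).map (Int.cast : ℤ → K)).rank =
      2 * (Finset.univ.filter fun i => (d i : K) ≠ 0).card := by
  rw [← Matrix.rank_submatrix _ (Equiv.refl (Fin N)) (blockSwap N p hp)]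
  have hdiag : ((blockSkew N p d).map (Int.cast : ℤ → K)).submatrix (Equiv.refl (Fin N))
      (blockSwap N p hp) =
      Matrix.diagonal fun a => (blockSkew N p d a (blockSwap N p hp a) : K) := by
    ext a b
    rcases eq_or_ne a b with rfl | hab
    · simp
    · rw [Matrix.diagonal_apply_ne _ hab]
      simp [blockSkew_eq_zero N p hp d fun e => hab ((blockSwap N p hp).injective e).symm]
  rw [hdiag, Matrix.rank_diagonal, ← Fintype.card_subtype]
  trans Fintype.card ({i : Fin p // (d i : K) ≠ 0} × Fin 2)
  swap
  · rw [Fintype.card_prod, Fintype.card_fin, mul_comm]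
  symm
  refine Fintype.card_of_bijective (f := fun x : {i : Fin p // (d i : K) ≠ 0} × Fin 2 =>
    (⟨⟨2 * x.1.1 + x.2, by omega⟩, ?_⟩ :
      {a : Fin N // (blockSkew N p d a (blockSwap N p hp a) : K) ≠ 0})) ⟨?_, ?_⟩
  · obtain ⟨⟨i, hi⟩, e⟩ := x
    have h1 : (2 * (i : ℕ) + e) / 2 = i := by omega
    rw [blockSkew_blockSwap]
    simp only [h1, i.isLt, dite_true, Fin.eta]
    split_ifs <;> simpa using hi
  · rintro ⟨⟨i, hi⟩, e⟩ ⟨⟨j, hj⟩, e'⟩ h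
    simp only [Subtype.mk.injEq, Fin.mk.injEq] at h
    have h1 : i = j := by ext; omega
    have h2 : e = e' := by ext; omega
    subst h1 h2
    rfl
  · rintro ⟨a, ha⟩
    rw [blockSkew_blockSwap] at ha
    by_cases h : (a : ℕ) / 2 < p
    · rw [dif_pos h] at ha
      refine ⟨⟨⟨⟨(a : ℕ) / 2, h⟩, ?_⟩, ⟨(a : ℕ) % 2, by omega⟩⟩, ?_⟩
      · split_ifs at ha
        · exact ha
        · simpa using ha
      · ext
        simp only
        omega
    · simp [h] at ha

open Matrix in
/-- Over a field the rank of a matrix is read off from its skew block form. -/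
theorem rank_eq_of_mul_mul_transpose_eq_blockSkew (K : Type*) [Field K] [DecidableEq K] {ι : Type}
    [Fintype ι] [DecidableEq ι] {N p : ℕ} (hp : 2 * p ≤ N) {d : Fin p → ℤ} {M : Matrix ι ι ℤ}
    {U : Matrix (Fin N) ι ℤ} {V : Matrix ι (Fin N) ℤ} (hVU : V * U = 1)
    (h : U * M * Uᵀ = blockSkew N p d) :
    (M.map (Int.cast : ℤ → K)).rank = 2 * (Finset.univ.filter fun i => (d i : K) ≠ 0).card := by
  have hM : M = V * blockSkew N p d * Vᵀ := by
    have h1 : Uᵀ * Vᵀ = 1 := by rw [← transpose_mul, hVU, transpose_one]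
    calc M = (V * U) * M * (Uᵀ * Vᵀ) := by rw [hVU, h1, Matrix.one_mul, Matrix.mul_one]
      _ = _ := by rw [← h]; simp only [Matrix.mul_assoc]
  have map_mul' : ∀ {α β γ : Type} [Fintype β] (A : Matrix α β ℤ) (B : Matrix β γ ℤ),
      (A * B).map (Int.cast : ℤ → K) = A.map Int.cast * B.map Int.cast := fun A B =>
    Matrix.map_mul (f := Int.castRingHom K)
  rw [← rank_blockSkew K N p hp d]
  apply le_antisymm
  · rw [hM, map_mul', map_mul']
    exact (Matrix.rank_mul_le_left _ _).trans (Matrix.rank_mul_le_right _ _)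
  · rw [← h, map_mul', map_mul']
    exact (Matrix.rank_mul_le_left _ _).trans (Matrix.rank_mul_le_right _ _)

open Matrix in
/-- If `k` annihilates the torsion of the cokernel of `M`, then every block of a skew block form
of `M` divides `k`. -/
theorem dvd_of_mul_mul_transpose_eq_blockSkew {ι : Type} [Fintype ι] [DecidableEq ι] {N p : ℕ}
    (hp : 2 * p ≤ N) {d : Fin p → ℤ} (hd : ∀ i, 1 ≤ d i) {M : Matrix ι ι ℤ}
    {U : Matrix (Fin N) ι ℤ} {V : Matrix ι (Fin N) ℤ} (hUV : U * V = 1) (hVU : V * U = 1)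
    (h : U * M * Uᵀ = blockSkew N p d) {k : ℤ}
    (hk : ∀ (c : ℤ) (u w : ι → ℤ), c ≠ 0 → M *ᵥ u = c • w → ∃ z, M *ᵥ z = k • w) (i : Fin p) :
    d i ∣ k := by
  let a : Fin N := ⟨2 * i, by omega⟩
  have hVU' : Uᵀ * Vᵀ = 1 := by rw [← transpose_mul, hVU, transpose_one]
  have ha : ∀ b, blockSkew N p d a b = if b = blockSwap N p hp a then d i else 0 := by
    intro b
    split_ifs with hb
    · rw [hb, blockSkew_blockSwap]
      simp [a]
    · exact blockSkew_eq_zero N p hp d hb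
  have hcol : blockSkew N p d *ᵥ Pi.single (blockSwap N p hp a) 1 = d i • Pi.single a 1 := by
    ext b
    simp only [mulVec_single_one, col_apply, Pi.smul_apply, smul_eq_mul]
    rcases eq_or_ne b a with rfl | hb
    · simp [ha]
    · rw [Pi.single_eq_of_ne hb, mul_zero]
      exact blockSkew_eq_zero N p hp d fun e => hb ((blockSwap N p hp).injective e).symm
  obtain ⟨z, hz⟩ := hk (d i) (Uᵀ *ᵥ Pi.single (blockSwap N p hp a) 1) (V *ᵥ Pi.single a 1)
    (by have := hd i; omega) (by
      rw [← mulVec_smul, ← hcol, ← h]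
      simp only [mulVec_mulVec, ← Matrix.mul_assoc, hVU, Matrix.one_mul])
  have h1 : blockSkew N p d *ᵥ (Vᵀ *ᵥ z) = k • Pi.single a 1 := by
    have : U *ᵥ (M *ᵥ z) = k • Pi.single a 1 := by
      rw [hz, mulVec_smul, mulVec_mulVec, hUV, one_mulVec]
    rw [← this, ← h, mulVec_mulVec, mulVec_mulVec, Matrix.mul_assoc (U * M), hVU',
      Matrix.mul_one]
  have h2 := congrFun h1 a
  simp only [mulVec, dotProduct, ha, ite_mul, zero_mul, Finset.sum_ite_eq',
    Finset.mem_univ, if_true, Pi.smul_apply, Pi.single_eq_same, smul_eq_mul, mul_one] at h2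
  exact ⟨_, h2.symm⟩

section Biantiperiodic

open Function Matrix Module

variable {A : Type*}

/-- Functions on `ℤ × ℤ` antiperiodic in both arguments; they are the extensions of `n × r`
matrices on which the map `X ↦ H_n X - X H_r` becomes translation invariant. -/
structure IsBiantiperiodic [Neg A] (n r : ℕ) (f : ℤ → ℤ → A) : Prop where
  left : ∀ j, Antiperiodic (fun i => f i j) n
  right : ∀ i, Antiperiodic (f i) r

/-- The antiperiodic extension to `ℤ` of a function on `Fin n`. -/
def antiperiodicExtend [AddCommGroup A] {n : ℕ} [NeZero n] (v : Fin n → A) (i : ℤ) : A :=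
  ((i / n).negOnePow : ℤ) • v (Fin.ofNat n (i % n).toNat)

theorem antiperiodicExtend_antiperiodic [AddCommGroup A] {n : ℕ} [NeZero n] (v : Fin n → A) :
    Antiperiodic (antiperiodicExtend v) n := by
  intro i
  have hn : (n : ℤ) ≠ 0 := by exact_mod_cast NeZero.ne n
  simp [antiperiodicExtend, Int.add_ediv_of_dvd_right, Int.ediv_self hn, Int.negOnePow_succ]

theorem antiperiodicExtend_apply [AddCommGroup A] {n : ℕ} [NeZero n] (v : Fin n → A) (i : Fin n) :
    antiperiodicExtend v i = v i := by
  have h1 : ((i : ℕ) : ℤ) / n = 0 := Int.ediv_eq_zero_of_lt (by omega) (by omega)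
  have h2 : ((i : ℕ) : ℤ) % n = i := Int.emod_eq_of_lt (by omega) (by omega)
  simp [antiperiodicExtend, h1, h2]

theorem Function.Antiperiodic.eq_negOnePow_smul [AddCommGroup A] {n : ℕ} {h : ℤ → A}
    (hh : Antiperiodic h n) (i : ℤ) : h i = ((i / n).negOnePow : ℤ) • h (i % n) := by
  rw [← hh.add_zsmul_eq, smul_eq_mul, mul_comm, Int.emod_add_mul_ediv]

theorem Function.Antiperiodic.eq_of_forall_fin [AddCommGroup A] {n : ℕ} [NeZero n] {h h' : ℤ → A}
    (hh : Antiperiodic h n) (hh' : Antiperiodic h' n) (e : ∀ i : Fin n, h i = h' i) : h = h' := by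
  ext i
  have hn : (n : ℤ) ≠ 0 := by exact_mod_cast NeZero.ne n
  have h0 := Int.emod_nonneg i hn
  have h1 : i % n < n := Int.emod_lt_of_pos i (by omega)
  have := e ⟨(i % n).toNat, by omega⟩
  simp only [Int.toNat_of_nonneg h0] at this
  rw [hh.eq_negOnePow_smul, hh'.eq_negOnePow_smul, this]

theorem Function.Antiperiodic.of_odd_mul [AddCommGroup A] {g n : ℕ} {h : ℤ → A}
    (hh : Antiperiodic h g) (hgn : g ∣ n) (hn : Odd (n / g)) : Antiperiodic h n := by
  obtain ⟨k, hk⟩ := hn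
  have : (n : ℤ) = (2 * k + 1 : ℕ) • (g : ℤ) := by
    rw [← hk, nsmul_eq_mul]
    exact_mod_cast (Nat.div_mul_cancel hgn).symm
  rw [this]
  exact hh.odd_nsmul_antiperiodic k

theorem Function.Antiperiodic.gcd [AddCommGroup A] {n r : ℕ} {h : ℤ → A} (hn : Antiperiodic h n)
    (hr : Antiperiodic h r) (hr0 : 0 < r) (hno : Odd (n / n.gcd r)) (hro : Odd (r / n.gcd r)) :
    Antiperiodic h (n.gcd r) := by
  set g := n.gcd r with hg
  have hg0 : (g : ℤ) ≠ 0 := by exact_mod_cast (Nat.gcd_pos_of_pos_right n hr0).ne'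
  have hbez : (g : ℤ) = n * n.gcdA r + r * n.gcdB r := Nat.gcd_eq_gcd_ab n r
  have hodd : Odd (n.gcdA r + n.gcdB r) := by
    obtain ⟨a, ha⟩ := hno
    obtain ⟨b, hb⟩ := hro
    have hn' : (n : ℤ) = g * (2 * a + 1) := by
      rw [← Nat.mul_div_cancel' (Nat.gcd_dvd_left n r), ← hg, ha]; push_cast; ring
    have hr' : (r : ℤ) = g * (2 * b + 1) := by
      rw [← Nat.mul_div_cancel' (Nat.gcd_dvd_right n r), ← hg, hb]; push_cast; ring
    have h1 : (g : ℤ) * ((2 * a + 1) * n.gcdA r + (2 * b + 1) * n.gcdB r) = g * 1 := by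
      rw [mul_one]
      conv_rhs => rw [hbez, hn', hr']
      ring
    have h2 := mul_left_cancel₀ hg0 h1
    exact ⟨-(a * n.gcdA r + b * n.gcdB r), by linarith⟩
  intro x
  have : x + (g : ℤ) = x + n.gcdA r • (n : ℤ) + n.gcdB r • (r : ℤ) := by
    rw [hbez, smul_eq_mul, smul_eq_mul]; ring
  rw [this, hr.add_zsmul_eq, hn.add_zsmul_eq, smul_smul, ← Units.val_mul, mul_comm,
    ← Int.negOnePow_add, Int.negOnePow_odd _ hodd]
  simp

theorem eq_sub_sub_of_diagonal_invariant {f : ℤ → ℤ → A} (hf : ∀ i j, f i j = f (i - 1) (j - 1))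
    (m i j : ℤ) : f i j = f (i - m) (j - m) := by
  induction m using Int.induction_on with
  | zero => simp
  | succ k ih => rw [ih, hf, sub_sub, sub_sub]
  | pred k ih => rw [ih, hf (i - (-k - 1))]; congr 1 <;> ring

theorem odd_odd_or_of_gcd {n r : ℕ} (hr0 : 0 < r) :
    (Odd (n / n.gcd r) ∧ Odd (r / n.gcd r)) ∨ Odd (n / n.gcd r + r / n.gcd r) := by
  have h := Nat.coprime_div_gcd_div_gcd (Nat.gcd_pos_of_pos_right n hr0)
  rcases Nat.even_or_odd (n / n.gcd r) with h1 | h1 <;>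
    rcases Nat.even_or_odd (r / n.gcd r) with h2 | h2
  · have := Nat.dvd_gcd h1.two_dvd h2.two_dvd
    rw [h] at this
    omega
  · exact Or.inr (h1.add_odd h2)
  · exact Or.inr (h1.add_even h2)
  · exact Or.inl ⟨h1, h2⟩

theorem IsBiantiperiodic.sub_lcm [AddCommGroup A] {n r : ℕ} {f : ℤ → ℤ → A}
    (hf : IsBiantiperiodic n r f) (h : Odd (n / n.gcd r + r / n.gcd r)) (i j : ℤ) :
    f (i - n.lcm r) (j - n.lcm r) = -f i j := by
  have h1 : ((n.lcm r : ℕ) : ℤ) = (r / n.gcd r) • (n : ℤ) := by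
    rw [Nat.lcm, Nat.mul_div_assoc _ (Nat.gcd_dvd_right n r), nsmul_eq_mul, mul_comm, Nat.cast_mul]
  have h2 : ((n.lcm r : ℕ) : ℤ) = (n / n.gcd r) • (r : ℤ) := by
    rw [Nat.lcm, mul_comm n, Nat.mul_div_assoc _ (Nat.gcd_dvd_left n r), nsmul_eq_mul, mul_comm,
      Nat.cast_mul]
  have e1 := (hf.left (j - n.lcm r)).sub_nsmul_eq (x := i) (r / n.gcd r)
  have e2 := (hf.right i).sub_nsmul_eq (x := j) (n / n.gcd r)
  beta_reduce at e1
  rw [← h1] at e1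
  rw [← h2] at e2
  rw [e1, e2, smul_smul, ← pow_add, add_comm, h.neg_one_pow, neg_one_smul]

section Invariant

variable [AddCommGroup A] {n r : ℕ} {f : ℤ → ℤ → A}

theorem IsBiantiperiodic.antiperiodic_gcd_of_invariant (hf : IsBiantiperiodic n r f)
    (hinv : ∀ i j, f i j = f (i - 1) (j - 1)) (hr0 : 0 < r) (hno : Odd (n / n.gcd r))
    (hro : Odd (r / n.gcd r)) : Antiperiodic (fun i => f i 0) (n.gcd r) := by
  refine Antiperiodic.gcd (hf.left 0) ?_ hr0 hno hro
  intro i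
  show f (i + r) 0 = -f i 0
  rw [eq_sub_sub_of_diagonal_invariant hinv r (i + r) 0, ← (hf.right i).neg 0]
  congr 1
  ring

theorem isBiantiperiodic_of_antiperiodic_gcd {h : ℤ → A} (hh : Antiperiodic h (n.gcd r))
    (hno : Odd (n / n.gcd r)) (hro : Odd (r / n.gcd r)) :
    IsBiantiperiodic n r fun i j => h (i - j) := by
  have h1 := hh.of_odd_mul (Nat.gcd_dvd_left n r) hno
  have h2 := hh.of_odd_mul (Nat.gcd_dvd_right n r) hro
  constructor
  · intro j i
    show h (i + n - j) = -h (i - j)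
    rw [← h1]
    congr 1
    ring
  · intro i j
    show h (i - (j + r)) = -h (i - j)
    rw [← h2.neg]
    congr 1
    ring

end Invariant

/-- The cokernel of `f ↦ f i j - f (i - 1) (j - 1)` on biantiperiodic functions has only
`2`-torsion. -/
theorem exists_diagonal_difference_eq {n r : ℕ} (hr0 : 0 < r) {u w : ℤ → ℤ → ℤ}
    (hu : IsBiantiperiodic n r u) (hw : IsBiantiperiodic n r w) {k : ℤ} (hk : k ≠ 0)
    (h : ∀ i j, u i j - u (i - 1) (j - 1) = k * w i j) :
    ∃ z, IsBiantiperiodic n r z ∧ ∀ i j, z i j - z (i - 1) (j - 1) = 2 * w i j := by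
  rcases odd_odd_or_of_gcd (n := n) hr0 with ⟨hno, hro⟩ | hodd
  · have : NeZero (n.gcd r) := ⟨(Nat.gcd_pos_of_pos_right n hr0).ne'⟩
    let red : ℤ → ℤ → ZMod k.natAbs := fun i j => (u i j : ZMod k.natAbs)
    have hred : IsBiantiperiodic n r red :=
      ⟨fun j i => by simpa [red] using congrArg (Int.cast : ℤ → ZMod k.natAbs) (hu.left j i),
        fun i j => by simpa [red] using congrArg (Int.cast : ℤ → ZMod k.natAbs) (hu.right i j)⟩
    have hinv : ∀ i j, red i j = red (i - 1) (j - 1) := by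
      intro i j
      rw [← sub_eq_zero, ← Int.cast_sub, h, Int.cast_mul, (ZMod.intCast_zmod_eq_zero_iff_dvd k _).2
        (Int.natAbs_dvd.2 dvd_rfl), zero_mul]
    let e : ℤ → ℤ := antiperiodicExtend fun a : Fin (n.gcd r) => u a 0
    have he : Antiperiodic e (n.gcd r) := antiperiodicExtend_antiperiodic _
    have hebi := isBiantiperiodic_of_antiperiodic_gcd he hno hro
    have hmod : (fun i => red i 0) = fun i => (e i : ZMod k.natAbs) := by
      refine (hred.antiperiodic_gcd_of_invariant hinv hr0 hno hro).eq_of_forall_fin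
        (fun i => ?_) fun a => ?_
      · show ((e (i + n.gcd r) : ℤ) : ZMod k.natAbs) = _
        rw [he]
        simp
      · simp only [red, e, antiperiodicExtend_apply]
    have hdvd : ∀ i j, k ∣ u i j - e (i - j) := by
      intro i j
      rw [← Int.natAbs_dvd, ← ZMod.intCast_zmod_eq_zero_iff_dvd, Int.cast_sub, sub_eq_zero]
      have h1 : red i j = red (i - j) 0 := by
        rw [eq_sub_sub_of_diagonal_invariant hinv j i j, sub_self]
      exact h1.trans (congrFun hmod (i - j))
    choose z hz using hdvd
    refine ⟨fun i j => 2 * z i j, ⟨fun j i => ?_, fun i j => ?_⟩, fun i j => ?_⟩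
    · have h1 : u (i + n) j = -u i j := hu.left j i
      have h2 : e (i + n - j) = -e (i - j) := hebi.left j i
      have h3 : z (i + n) j = -z i j := mul_left_cancel₀ hk (by
        rw [← hz, mul_neg, ← hz]; rw [h1, h2]; ring)
      simp only [h3, mul_neg]
    · have h1 : u i (j + r) = -u i j := hu.right i j
      have h2 : e (i - (j + r)) = -e (i - j) := hebi.right i j
      have h3 : z i (j + r) = -z i j := mul_left_cancel₀ hk (by
        rw [← hz, mul_neg, ← hz]; rw [h1, h2]; ring)
      simp only [h3, mul_neg]
    · have h3 : z i j - z (i - 1) (j - 1) = w i j := mul_left_cancel₀ hk (by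
        rw [mul_sub, ← hz, ← hz, ← h, sub_sub_sub_cancel_right]; ring)
      rw [← h3]
      ring
  · refine ⟨fun i j => ∑ m ∈ Finset.range (n.lcm r), w (i - m) (j - m),
      ⟨fun j i => ?_, fun i j => ?_⟩, fun i j => ?_⟩
    · simp only [← Finset.sum_neg_distrib]
      refine Finset.sum_congr rfl fun m _ => ?_
      rw [add_sub_right_comm]
      exact hw.left _ _
    · simp only [← Finset.sum_neg_distrib]
      refine Finset.sum_congr rfl fun m _ => ?_
      rw [add_sub_right_comm]
      exact hw.right _ _
    · rw [← Finset.sum_sub_distrib]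
      have h1 := Finset.sum_range_sub' (fun m : ℕ => w (i - m) (j - m)) (n.lcm r)
      rw [hw.sub_lcm hodd] at h1
      convert h1 using 1
      · refine Finset.sum_congr rfl fun m _ => ?_
        congr 2 <;> push_cast <;> ring
      · simp; ring

theorem HmatZ_swap (k : ℕ) (i j : Fin k) : HmatZ k i j = -HmatZ k j i := by
  simp only [HmatZ, Matrix.of_apply]
  split_ifs <;> omega

theorem sum_HmatZ_mul_add [CommRing A] {n : ℕ} {h : ℤ → A} (hh : Antiperiodic h n) (i : Fin n) :
    ∑ s : Fin n, (HmatZ n i s : A) * h s + h i = ∑ k ∈ Finset.range n, h (i - k) := by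
  have h1 : ∑ s : Fin n, (HmatZ n i s : A) * h s + h i =
      ∑ s ∈ Finset.range n, if s ≤ (i : ℕ) then h s else -h s := by
    rw [← Fin.sum_univ_eq_sum_range (fun s => if s ≤ (i : ℕ) then h s else -h s)]
    have h2 : h i = ∑ s : Fin n, if s = i then h s else 0 := by simp
    conv_lhs => rw [h2]
    rw [← Finset.sum_add_distrib]
    refine Finset.sum_congr rfl fun s _ => ?_
    simp only [HmatZ, Matrix.of_apply, Fin.ext_iff]
    split_ifs <;> first | omega | simp
  rw [h1]
  let φ : ℕ → ℕ := fun k => if k ≤ (i : ℕ) then i - k else n + i - k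
  refine Finset.sum_nbij' φ φ ?_ ?_ ?_ ?_ ?_
  · intro a ha
    simp only [Finset.mem_range, φ] at ha ⊢
    split_ifs <;> omega
  · intro a ha
    simp only [Finset.mem_range, φ] at ha ⊢
    split_ifs <;> omega
  · intro a ha
    simp only [Finset.mem_range, φ] at ha ⊢
    split_ifs <;> omega
  · intro a ha
    simp only [Finset.mem_range, φ] at ha ⊢
    split_ifs <;> omega
  · intro a ha
    simp only [Finset.mem_range, φ] at ha ⊢
    split_ifs with hle
    · congr 1
      omega
    · rw [← hh.sub_eq]
      congr 1
      omega

/-- The translation invariant form of the map `X ↦ H_n X - X H_r`. -/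
def windowSum [CommRing A] (n r : ℕ) (f : ℤ → ℤ → A) (i j : ℤ) : A :=
  ∑ k ∈ Finset.range n, f (i - k) j + ∑ k ∈ Finset.range r, f i (j - k) - 2 * f i j

section WindowSum

variable [CommRing A] {n r : ℕ} {f : ℤ → ℤ → A}

theorem Jdef_mulVec_apply_s12 (hf : IsBiantiperiodic n r f) (i : Fin n) (j : Fin r) :
    ((Jdef n r).map (Int.cast : ℤ → A) *ᵥ fun q => f q.1 q.2) (i, j) = windowSum n r f i j := by
  have h1 := sum_HmatZ_mul_add (hf.left j) i
  have h2 := sum_HmatZ_mul_add (hf.right i) j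
  rw [windowSum, ← h1, ← h2]
  simp only [mulVec, dotProduct, Jdef, Matrix.map_apply, Matrix.of_apply, Fintype.sum_prod_type,
    Int.cast_sub, Int.cast_ite, Int.cast_zero, sub_mul,
    Finset.sum_sub_distrib, mul_ite, mul_one, mul_zero, ite_mul, one_mul, zero_mul]
  simp only [Finset.sum_ite_eq, Finset.mem_univ, if_true]
  rw [Finset.sum_comm]
  simp only [Finset.sum_ite_eq, Finset.mem_univ, if_true, HmatZ_swap r j, Int.cast_neg, neg_mul,
    Finset.sum_neg_distrib]
  ring

theorem IsBiantiperiodic.windowSum (hf : IsBiantiperiodic n r f) :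
    IsBiantiperiodic n r (windowSum n r f) := by
  constructor
  · intro j i
    have h := fun j i => hf.left j i
    beta_reduce at h
    simp only [_root_.windowSum, add_sub_right_comm _ (n : ℤ), h, Finset.sum_neg_distrib]
    ring
  · intro i j
    have h := fun i j => hf.right i j
    simp only [_root_.windowSum, add_sub_right_comm _ (r : ℤ), h, Finset.sum_neg_distrib]
    ring

theorem sum_range_sub_sum_range_of_antiperiodic {h : ℤ → A} (hh : Antiperiodic h n) (i : ℤ) :
    ∑ k ∈ Finset.range n, h (i - k) - ∑ k ∈ Finset.range n, h (i - 1 - k) = 2 * h i := by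
  have h1 := Finset.sum_range_sub' (fun k : ℕ => h (i - k)) n
  have h2 : ∀ k : ℕ, i - ((k + 1 : ℕ) : ℤ) = i - 1 - k := fun k => by push_cast; ring
  simp only [h2, hh.sub_eq, Nat.cast_zero, sub_zero, Finset.sum_sub_distrib] at h1
  rw [h1]
  ring

theorem mixed_difference_windowSum (hf : IsBiantiperiodic n r f) (i j : ℤ) :
    windowSum n r f i j - windowSum n r f (i - 1) j - windowSum n r f i (j - 1) +
      windowSum n r f (i - 1) (j - 1) = 2 * (f i j - f (i - 1) (j - 1)) := by
  have h1 := fun j => sum_range_sub_sum_range_of_antiperiodic (hf.left j) i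
  have h2 := fun i => sum_range_sub_sum_range_of_antiperiodic (hf.right i) j
  simp only [windowSum]
  linear_combination h1 j - h1 (j - 1) + h2 i - h2 (i - 1)

theorem windowSum_mixed_difference (hf : IsBiantiperiodic n r f) (i j : ℤ) :
    windowSum n r (fun i j => f i j - f (i - 1) j - f i (j - 1) + f (i - 1) (j - 1)) i j =
      2 * (f i j - f (i - 1) (j - 1)) := by
  rw [← mixed_difference_windowSum hf]
  simp only [windowSum, Finset.sum_add_distrib, Finset.sum_sub_distrib, sub_right_comm _ (1 : ℤ)]
  ring

/-- `2 * windowSum n r` is the diagonal difference of a double window sum. -/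
theorem exists_diagonal_difference_eq_two_mul_windowSum (hf : IsBiantiperiodic n r f) :
    ∃ g : ℤ → ℤ → A, IsBiantiperiodic n r g ∧
      ∀ i j, g i j - g (i - 1) (j - 1) = 2 * windowSum n r f i j := by
  have hl := fun i j => hf.left j i
  have hr := fun i j => hf.right i j
  beta_reduce at hl
  refine ⟨fun i j => ∑ k ∈ Finset.range n, ∑ l ∈ Finset.range r, f (i - k) (j - l),
    ⟨fun j i => ?_, fun i j => ?_⟩, fun i j => ?_⟩
  · simp only [add_sub_right_comm _ (n : ℤ), hl, Finset.sum_neg_distrib]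
  · simp only [add_sub_right_comm _ (r : ℤ), hr, Finset.sum_neg_distrib]
  · have h1 := fun i => sum_range_sub_sum_range_of_antiperiodic (hf.right i) j
    have h2 : Antiperiodic (fun i => ∑ l ∈ Finset.range r, f i (j - 1 - l)) n := fun i => by
      simp only [hl, Finset.sum_neg_distrib]
    have h3 := sum_range_sub_sum_range_of_antiperiodic h2 i
    have h4 := Finset.sum_congr (rfl : Finset.range n = Finset.range n) fun k _ => h1 (i - k)
    rw [Finset.sum_sub_distrib, ← Finset.mul_sum] at h4
    simp only [windowSum]
    linear_combination h4 + h3 - 2 * h1 i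

theorem IsBiantiperiodic.mixed_difference (hf : IsBiantiperiodic n r f) :
    IsBiantiperiodic n r fun i j => f i j - f (i - 1) j - f i (j - 1) + f (i - 1) (j - 1) := by
  constructor
  · intro j i
    have h := fun j i => hf.left j i
    beta_reduce at h
    simp only [add_sub_right_comm _ (n : ℤ), h]
    ring
  · intro i j
    have h := fun i j => hf.right i j
    simp only [add_sub_right_comm _ (r : ℤ), h]
    ring

theorem IsBiantiperiodic.zero : IsBiantiperiodic n r fun _ _ => (0 : A) :=
  ⟨fun _ _ => by simp, fun _ _ => by simp⟩

variable [NeZero n] [NeZero r]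

theorem exists_isBiantiperiodic_extension (v : Fin n × Fin r → A) :
    ∃ f : ℤ → ℤ → A, IsBiantiperiodic n r f ∧ v = fun q => f q.1 q.2 := by
  refine ⟨antiperiodicExtend fun i => antiperiodicExtend fun j => v (i, j),
    ⟨fun j i => ?_, fun i j => ?_⟩, ?_⟩
  · exact congrFun (antiperiodicExtend_antiperiodic (n := n) _ i) j
  · have := antiperiodicExtend_antiperiodic (n := r)
      (fun j => v (Fin.ofNat n (i % n).toNat, j)) j
    simp only [antiperiodicExtend, Pi.smul_apply] at this ⊢
    rw [this, smul_neg]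
  · ext ⟨i, j⟩
    simp only [antiperiodicExtend_apply]

theorem IsBiantiperiodic.ext {f f' : ℤ → ℤ → A} (hf : IsBiantiperiodic n r f)
    (hf' : IsBiantiperiodic n r f') (h : ∀ (i : Fin n) (j : Fin r), f i j = f' i j) : f = f' := by
  have h1 : ∀ i : Fin n, f i = f' i := fun i =>
    (hf.right i).eq_of_forall_fin (hf'.right i) (h i)
  ext i j
  exact congrFun ((hf.left j).eq_of_forall_fin (hf'.left j) fun i => congrFun (h1 i) j) i

theorem Jdef_mulVec_eq_iff (hf : IsBiantiperiodic n r f) {f' : ℤ → ℤ → A}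
    (hf' : IsBiantiperiodic n r f') :
    ((Jdef n r).map (Int.cast : ℤ → A) *ᵥ fun q => f q.1 q.2) = (fun q => f' q.1 q.2) ↔
      windowSum n r f = f' := by
  constructor
  · intro h
    refine hf.windowSum.ext hf' fun i j => ?_
    rw [← Jdef_mulVec_apply_s12 hf, h]
  · rintro rfl
    ext ⟨i, j⟩
    exact Jdef_mulVec_apply_s12 hf i j

end WindowSum

/-- The torsion of the cokernel of `Jdef n r` is annihilated by `4`. -/
theorem Jdef_torsion {n r : ℕ} [NeZero n] [NeZero r] {c : ℤ} {u w : Fin n × Fin r → ℤ}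
    (hc : c ≠ 0) (h : Jdef n r *ᵥ u = c • w) : ∃ z, Jdef n r *ᵥ z = (4 : ℤ) • w := by
  have hcast : (Jdef n r).map (Int.cast : ℤ → ℤ) = Jdef n r := by ext; simp
  obtain ⟨f, hf, rfl⟩ := exists_isBiantiperiodic_extension u
  obtain ⟨g, hg, rfl⟩ := exists_isBiantiperiodic_extension w
  have smul_bi : ∀ (k : ℤ) {g : ℤ → ℤ → ℤ}, IsBiantiperiodic n r g →
      IsBiantiperiodic n r fun i j => k * g i j := fun k g hg =>
    ⟨fun j i => by have := hg.left j i; simp_all, fun i j => by have := hg.right i j; simp_all⟩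
  have h1 : windowSum n r f = fun i j => c * g i j := by
    rw [← Jdef_mulVec_eq_iff hf (smul_bi c hg), hcast, h]
    rfl
  obtain ⟨P, hP, hPf⟩ := exists_diagonal_difference_eq_two_mul_windowSum hf
  obtain ⟨z, hz, hzg⟩ := exists_diagonal_difference_eq (Nat.pos_of_neZero r) hP hg
    (mul_ne_zero two_ne_zero hc) fun i j => by rw [hPf, h1, mul_assoc]
  refine ⟨fun q => z q.1 q.2 - z (q.1 - 1) q.2 - z q.1 (q.2 - 1) + z (q.1 - 1) (q.2 - 1), ?_⟩
  have h2 := (Jdef_mulVec_eq_iff hz.mixed_difference (smul_bi 4 hg)).2 (by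
    ext i j
    rw [windowSum_mixed_difference hz, hzg]
    ring)
  rw [hcast] at h2
  exact h2

theorem eq_zero_of_antiperiodic_of_invariant {n : ℕ} {h : ℤ → ℚ} (hh : Antiperiodic h n)
    (hinv : ∀ i, h i = h (i - 1)) (i : ℤ) : h i = 0 := by
  have h1 := eq_sub_sub_of_diagonal_invariant (f := fun i _ => h i) (fun i _ => hinv i) n i 0
  beta_reduce at h1
  rw [hh.sub_eq] at h1
  linarith

theorem windowSum_eq_zero_iff {n r : ℕ} {f : ℤ → ℤ → ℚ} (hf : IsBiantiperiodic n r f) :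
    (windowSum n r f = fun _ _ => 0) ↔ ∀ i j, f i j = f (i - 1) (j - 1) := by
  constructor
  · intro h i j
    have := mixed_difference_windowSum hf i j
    rw [h] at this
    linarith
  · intro h
    have hw := hf.windowSum
    have hl := fun i j => hw.left j i
    have hr := fun i j => hw.right i j
    beta_reduce at hl
    have h1 : ∀ i j, windowSum n r f i j - windowSum n r f (i - 1) j = 0 := fun i =>
      eq_zero_of_antiperiodic_of_invariant (n := r)
        (h := fun j => windowSum n r f i j - windowSum n r f (i - 1) j)
        (fun j => by simp only [hr]; ring) fun j => by
          have := mixed_difference_windowSum hf i j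
          rw [← h, sub_self] at this
          linarith
    ext i j
    exact eq_zero_of_antiperiodic_of_invariant (hw.left j) (fun i => sub_eq_zero.1 (h1 i j)) i

section Kernel

variable {n r : ℕ} [NeZero n] [NeZero r]

theorem mem_ker_Jdef_iff {f : ℤ → ℤ → ℚ} (hf : IsBiantiperiodic n r f) :
    (fun q => f q.1 q.2) ∈ LinearMap.ker ((Jdef n r).map (Int.cast : ℤ → ℚ)).mulVecLin ↔
      ∀ i j, f i j = f (i - 1) (j - 1) := by
  rw [LinearMap.mem_ker, Matrix.mulVecLin_apply, ← windowSum_eq_zero_iff hf,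
    ← Jdef_mulVec_eq_iff hf IsBiantiperiodic.zero]
  rfl

theorem finrank_ker_Jdef :
    finrank ℚ (LinearMap.ker ((Jdef n r).map (Int.cast : ℤ → ℚ)).mulVecLin) = corankJ n r := by
  have hr0 : 0 < r := Nat.pos_of_neZero r
  have hn0 : 0 < n := Nat.pos_of_neZero n
  rcases odd_odd_or_of_gcd (n := n) hr0 with hodd | hodd
  · rw [corankJ, if_pos hodd]
    obtain ⟨hno, hro⟩ := hodd
    have hg : NeZero (n.gcd r) := ⟨(Nat.gcd_pos_of_pos_right n hr0).ne'⟩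
    have hgn : n.gcd r ≤ n := Nat.gcd_le_left r hn0
    let φ : LinearMap.ker ((Jdef n r).map (Int.cast : ℤ → ℚ)).mulVecLin →ₗ[ℚ]
        (Fin (n.gcd r) → ℚ) :=
      (LinearMap.funLeft ℚ ℚ fun a => (Fin.castLE hgn a, (0 : Fin r))) ∘ₗ Submodule.subtype _
    have hφ : Bijective φ := by
      constructor
      · rw [← LinearMap.ker_eq_bot, LinearMap.ker_eq_bot']
        rintro ⟨v, hv⟩ h
        obtain ⟨f, hf, rfl⟩ := exists_isBiantiperiodic_extension v
        have hinv := (mem_ker_Jdef_iff hf).1 hv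
        have h0 : (fun i => f i 0) = fun _ => 0 :=
          (hf.antiperiodic_gcd_of_invariant hinv hr0 hno hro).eq_of_forall_fin
            (fun _ => by simp) fun a => by simpa [φ, LinearMap.funLeft] using congrFun h a
        ext ⟨i, j⟩
        show f i j = 0
        rw [eq_sub_sub_of_diagonal_invariant hinv j i j, sub_self]
        exact congrFun h0 _
      · intro a
        have hbi := isBiantiperiodic_of_antiperiodic_gcd (antiperiodicExtend_antiperiodic a) hno hro
        refine ⟨⟨_, (mem_ker_Jdef_iff hbi).2 fun i j => by rw [sub_sub_sub_cancel_right]⟩, ?_⟩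
        ext k
        simpa [φ, LinearMap.funLeft] using antiperiodicExtend_apply a k
    rw [(LinearEquiv.ofBijective φ hφ).finrank_eq, finrank_fin_fun]
  · rw [corankJ, if_neg (by rintro ⟨h1, h2⟩; exact Nat.not_odd_iff_even.2 (h1.add_odd h2) hodd)]
    rw [LinearMap.ker_eq_bot'.2, finrank_bot]
    intro v hv
    obtain ⟨f, hf, rfl⟩ := exists_isBiantiperiodic_extension v
    have hinv := (mem_ker_Jdef_iff hf).1 hv
    ext ⟨i, j⟩
    have h1 := hf.sub_lcm hodd i j
    rw [← eq_sub_sub_of_diagonal_invariant hinv] at h1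
    show f i j = 0
    linarith

theorem rank_Jdef_add_corankJ :
    ((Jdef n r).map (Int.cast : ℤ → ℚ)).rank + corankJ n r = n * r := by
  rw [← finrank_ker_Jdef, Matrix.rank, LinearMap.finrank_range_add_finrank_ker]
  simp

end Kernel

end Biantiperiodic
section ModTwo

open Matrix Module

theorem Jdef_mulVec_zmod_two {n r : ℕ} (v : Fin n × Fin r → ZMod 2) (i : Fin n) (j : Fin r) :
    ((Jdef n r).map (Int.cast : ℤ → ZMod 2) *ᵥ v) (i, j) =
      ∑ s, v (s, j) + ∑ t, v (i, t) := by
  have hH : ∀ (k : ℕ) (a b : Fin k), (HmatZ k a b : ZMod 2) = 1 - if a = b then 1 else 0 := by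
    intro k a b
    simp only [HmatZ, Matrix.of_apply, Fin.ext_iff]
    split_ifs <;> first | omega | simp
  simp only [mulVec, dotProduct, Jdef, Matrix.map_apply, Matrix.of_apply, Fintype.sum_prod_type,
    Int.cast_sub, Int.cast_mul, Int.cast_ite, Int.cast_one, Int.cast_zero, hH]
  simp only [sub_mul, Finset.sum_sub_distrib, mul_ite, mul_one, mul_zero, ite_mul, one_mul,
    zero_mul, Finset.sum_ite_eq, Finset.mem_univ, if_true]
  rw [Finset.sum_comm]
  simp only [Finset.sum_ite_eq, Finset.sum_ite_eq', Finset.sum_sub_distrib, Finset.mem_univ,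
    if_true]
  generalize v (i, j) = a
  generalize ∑ s, v (s, j) = b
  generalize ∑ t, v (i, t) = c
  revert a b c
  decide

theorem mem_ker_Jdef_zmod_two_iff {n r : ℕ} {v : Fin n × Fin r → ZMod 2} :
    v ∈ LinearMap.ker ((Jdef n r).map (Int.cast : ℤ → ZMod 2)).mulVecLin ↔
      ∀ i j, ∑ s, v (s, j) = ∑ t, v (i, t) := by
  rw [LinearMap.mem_ker, Matrix.mulVecLin_apply, funext_iff, Prod.forall]
  simp only [Jdef_mulVec_zmod_two, Pi.zero_apply, CharTwo.add_eq_zero]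

theorem finrank_ker_Jdef_zmod_two_le (n r : ℕ) :
    finrank (ZMod 2) (LinearMap.ker
      ((Jdef (n + 1) (r + 1)).map (Int.cast : ℤ → ZMod 2)).mulVecLin) ≤ n * r + 1 := by
  let φ : (Fin (n + 1) × Fin (r + 1) → ZMod 2) →ₗ[ZMod 2] (Fin n × Fin r → ZMod 2) × ZMod 2 :=
    (LinearMap.funLeft (ZMod 2) (ZMod 2) fun q => (q.1.succ, q.2.succ)).prod
      (∑ t, LinearMap.proj ((0 : Fin (n + 1)), t))
  have hφ : Function.Injective (φ ∘ₗ (LinearMap.ker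
      ((Jdef (n + 1) (r + 1)).map (Int.cast : ℤ → ZMod 2)).mulVecLin).subtype) := by
    rw [← LinearMap.ker_eq_bot, LinearMap.ker_eq_bot']
    rintro ⟨v, hv⟩ h
    rw [mem_ker_Jdef_zmod_two_iff] at hv
    have hblock : ∀ i j, v (Fin.succ i, Fin.succ j) = 0 := fun i j =>
      congrFun (congrArg Prod.fst h) (i, j)
    have hrow0 : ∑ t, v (0, t) = 0 := by
      simpa [φ] using congrArg Prod.snd h
    have hcol : ∀ j, ∑ s, v (s, j) = 0 := fun j => (hv 0 j).trans hrow0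
    have hrow : ∀ i, ∑ t, v (i, t) = 0 := fun i => (hv i 0).symm.trans (hcol 0)
    have hv0 : ∀ i, v (Fin.succ i, 0) = 0 := fun i => by
      simpa [Fin.sum_univ_succ, hblock] using hrow i.succ
    have h0v : ∀ j, v (0, j) = 0 := fun j => by
      refine Fin.cases ?_ (fun j => ?_) j
      · simpa [Fin.sum_univ_succ, hv0] using hcol 0
      · simpa [Fin.sum_univ_succ, hblock] using hcol j.succ
    ext ⟨i, j⟩
    refine Fin.cases (h0v j) (fun i => Fin.cases (hv0 i) (fun j => hblock i j) j) i
  simpa using LinearMap.finrank_le_finrank_of_injective hφ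

theorem le_finrank_ker_Jdef_zmod_two (n r : ℕ) :
    n * r ≤ finrank (ZMod 2) (LinearMap.ker
      ((Jdef (n + 1) (r + 1)).map (Int.cast : ℤ → ZMod 2)).mulVecLin) := by
  -- prepend to every row, and then to every column, its own sum
  let ψ : (Fin n × Fin r → ZMod 2) →ₗ[ZMod 2] (Fin (n + 1) × Fin (r + 1) → ZMod 2) :=
    { toFun := fun B q => (Fin.cons (∑ i, (Fin.cons (∑ j, B (i, j)) (fun j => B (i, j)) :
          Fin (r + 1) → ZMod 2) q.2)
        (fun i => (Fin.cons (∑ j, B (i, j)) (fun j => B (i, j)) : Fin (r + 1) → ZMod 2) q.2) :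
          Fin (n + 1) → ZMod 2) q.1
      map_add' := by
        intro B C
        ext ⟨i, j⟩
        refine Fin.cases ?_ (fun i => ?_) i <;> refine Fin.cases ?_ (fun j => ?_) j <;>
          simp [Finset.sum_add_distrib]
      map_smul' := by
        intro c B
        ext ⟨i, j⟩
        refine Fin.cases ?_ (fun i => ?_) i <;> refine Fin.cases ?_ (fun j => ?_) j <;>
          simp [Finset.mul_sum] }
  have hmem : ∀ B, ψ B ∈ LinearMap.ker
      ((Jdef (n + 1) (r + 1)).map (Int.cast : ℤ → ZMod 2)).mulVecLin := by
    intro B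
    rw [mem_ker_Jdef_zmod_two_iff]
    have hcol : ∀ j, ∑ s, ψ B (s, j) = 0 := fun j => by
      simp [ψ, Fin.sum_univ_succ, CharTwo.add_self_eq_zero]
    have hrow : ∀ i, ∑ t, ψ B (i, t) = 0 := fun i => by
      refine Fin.cases ?_ (fun i => ?_) i
      · simp only [ψ, LinearMap.coe_mk, AddHom.coe_mk, Fin.cons_zero]
        rw [Finset.sum_comm]
        simp [Fin.sum_univ_succ, CharTwo.add_self_eq_zero]
      · simp [ψ, Fin.sum_univ_succ, CharTwo.add_self_eq_zero]
    exact fun i j => (hcol j).trans (hrow i).symm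
  have hinj : Function.Injective (ψ.codRestrict _ hmem) := by
    intro B C h
    ext ⟨i, j⟩
    simpa [ψ] using congrFun (congrArg Subtype.val h) (i.succ, j.succ)
  simpa using LinearMap.finrank_le_finrank_of_injective hinj

theorem rank_Jdef_zmod_two_bounds {n r : ℕ} (hn : 0 < n) (hr : 0 < r) :
    n + r ≤ ((Jdef n r).map (Int.cast : ℤ → ZMod 2)).rank + 2 ∧
      ((Jdef n r).map (Int.cast : ℤ → ZMod 2)).rank + 1 ≤ n + r := by
  obtain ⟨n, rfl⟩ := Nat.exists_eq_succ_of_ne_zero hn.ne'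
  obtain ⟨r, rfl⟩ := Nat.exists_eq_succ_of_ne_zero hr.ne'
  have h1 := finrank_ker_Jdef_zmod_two_le n r
  have h2 := le_finrank_ker_Jdef_zmod_two n r
  have h3 := LinearMap.finrank_range_add_finrank_ker
    ((Jdef (n + 1) (r + 1)).map (Int.cast : ℤ → ZMod 2)).mulVecLin
  have h4 : finrank (ZMod 2) (Fin (n + 1) × Fin (r + 1) → ZMod 2) = n * r + n + r + 1 := by
    simp
    ring
  rw [h4] at h3
  simp only [Nat.succ_eq_add_one, Matrix.rank]
  omega

end ModTwo

theorem Jdef_transpose (n r : ℕ) : (Jdef n r).transpose = -Jdef n r := by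
  ext p q
  simp only [Jdef, Matrix.transpose_apply, Matrix.of_apply, Matrix.neg_apply, HmatZ_swap n q.1 p.1,
    HmatZ_swap r p.2 q.2, eq_comm (a := q.1), eq_comm (a := q.2)]
  ring

/-- For `n ≥ r ≥ 1`, the defining matrix `J` of `M̄_q(n,r)` has a
block diagonal form with exactly `d₀ = ⌊(n+r-1)/2⌋` blocks `((0,1),(-1,0))`, exactly
`max {0, (nr - c_{n,r})/2 - d₀}` blocks `((0,2),(-2,0))` or `((0,4),(-4,0))`, and a zero
block of size `c_{n,r}`. -/
theorem Jdef_block_form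
    (n r : ℕ) (hr : 1 ≤ r) (hrn : r ≤ n) :
    ∃ (p : ℕ) (d : Fin p → ℤ),
      IsBlockForm n r p d ∧
      2 * p + corankJ n r = n * r ∧
      (∀ i : Fin p, d i = 1 ∨ d i = 2 ∨ d i = 4) ∧
      (Finset.univ.filter fun i : Fin p => d i = 1).card = (n + r - 1) / 2 ∧
      (Finset.univ.filter fun i : Fin p => d i = 2 ∨ d i = 4).card =
        (n * r - corankJ n r) / 2 - (n + r - 1) / 2 := by
  have : NeZero n := ⟨by omega⟩
  have : NeZero r := ⟨by omega⟩
  obtain ⟨p, d, hp, hd, U, V, hUV, hVU, hU⟩ := exists_mul_mul_transpose_eq_blockSkew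
    (ι := Fin n × Fin r) (N := n * r) (by simp) (Jdef n r) (Jdef_transpose n r)
  have hdvd : ∀ i, d i ∣ 4 := dvd_of_mul_mul_transpose_eq_blockSkew hp hd hUV hVU hU
    fun _ _ _ => Jdef_torsion
  have h124 : ∀ i, d i = 1 ∨ d i = 2 ∨ d i = 4 := by
    intro i
    have h1 := hd i
    have h2 := Int.le_of_dvd (by norm_num) (hdvd i)
    have h3 := hdvd i
    generalize d i = x at *
    interval_cases x <;> omega
  have hrank := rank_eq_of_mul_mul_transpose_eq_blockSkew ℚ hp hVU hU
  rw [Finset.filter_true_of_mem fun i _ => by have := hd i; norm_cast; omega,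
    Finset.card_univ, Fintype.card_fin] at hrank
  have hcorank : 2 * p + corankJ n r = n * r := by rw [← hrank, rank_Jdef_add_corankJ]
  have hone : (Finset.univ.filter fun i : Fin p => d i = 1).card = (n + r - 1) / 2 := by
    have h1 := rank_eq_of_mul_mul_transpose_eq_blockSkew (ZMod 2) hp hVU hU
    have h2 := rank_Jdef_zmod_two_bounds (n := n) (r := r) (by omega) hr
    rw [Finset.filter_congr fun i _ => show (d i : ZMod 2) ≠ 0 ↔ d i = 1 by
      rcases h124 i with h | h | h <;> rw [h] <;> decide] at h1
    omega
  refine ⟨p, d, ⟨hp, hd, U, V, hUV, hVU, hU⟩, hcorank, h124, hone, ?_⟩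
  have hsplit := Finset.card_filter_add_card_filter_not (s := Finset.univ)
    fun i : Fin p => d i = 1
  rw [Finset.card_univ, Fintype.card_fin, hone, Finset.filter_congr fun i _ =>
    show ¬d i = 1 ↔ d i = 2 ∨ d i = 4 by have := h124 i; omega] at hsplit
  omega
end
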